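/- Let T be a semigroup with the F-property and let T⁰ = T ⊔ {0} be T with an adjoined zero. Let τ_Ac be the topology on T⁰ in which every element of T is isolated and the family of all subsets U ⊆ T⁰ with 0 ∈ U and T⁰ ∖ U finite is a base of neighbourhoods at 0. Then (T⁰, τ_Ac) is a Hausdorff compact semitopological semigroup. -/

import Mathlib

namespace GK

/-- The topology `τ_Ac` on `T⁰ = T ⊔ {0}`: every element of `T` is isolated,
and the sets `U ∋ 0` with finite complement form a base of neighbourhoods
at `0`. -/
def tauAc (T : Type*) : TopologicalSpace (WithZero T) where
  IsOpen U := (0 : WithZero T) ∈ U → Uᶜ.Finite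
  isOpen_univ := fun _ => by simp
  isOpen_inter := by
    intro U V hU hV h
    rw [Set.compl_inter]
    exact (hU h.1).union (hV h.2)
  isOpen_sUnion := by
    intro s hs h
    obtain ⟨U, hUs, hU0⟩ := h
    exact (hs U hUs hU0).subset (Set.compl_subset_compl.2 (Set.subset_sUnion_of_mem hUs))

theorem isOpen_tauAc_iff {T : Type*} {U : Set (WithZero T)} :
    @IsOpen _ (tauAc T) U ↔ ((0 : WithZero T) ∈ U → Uᶜ.Finite) := Iff.rfl

theorem t2Space_tauAc (T : Type*) : @T2Space (WithZero T) (tauAc T) := by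
  let _ := tauAc T
  have separate : ∀ x y : WithZero T, y ≠ 0 →
      x ≠ y → ∃ u v : Set (WithZero T), IsOpen u ∧ IsOpen v ∧ x ∈ u ∧ y ∈ v ∧ Disjoint u v := by
    intro x y hy hxy
    refine ⟨{y}ᶜ, {y}, ?_, ?_, hxy, rfl, disjoint_compl_left⟩
    · exact isOpen_tauAc_iff.2 fun _ => by simp
    · exact isOpen_tauAc_iff.2 fun h => absurd h.symm hy
  refine ⟨fun x y hxy => ?_⟩
  by_cases hy : y = 0
  · obtain ⟨u, v, hu, hv, hyu, hxv, huv⟩ :=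
      separate y x (fun hx => hxy (hx.trans hy.symm)) hxy.symm
    exact ⟨v, u, hv, hu, hxv, hyu, huv.symm⟩
  · exact separate x y hy hxy

theorem compactSpace_tauAc (T : Type*) : @CompactSpace (WithZero T) (tauAc T) := by
  let _ := tauAc T
  refine ⟨isCompact_iff_ultrafilter_le_nhds.2 fun f _ => ?_⟩
  rcases f.le_cofinite_or_eq_pure with hf | ⟨x, rfl⟩
  · refine ⟨0, Set.mem_univ _, hf.trans ?_⟩
    intro s hs
    obtain ⟨U, hUs, hU, h0⟩ := mem_nhds_iff.1 hs
    exact Filter.mem_of_superset (Filter.mem_cofinite.2 (isOpen_tauAc_iff.1 hU h0)) hUs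
  · exact ⟨x, Set.mem_univ _, pure_le_nhds x⟩

/-- A zero-preserving map whose fibres over nonzero points are finite is continuous. -/
theorem continuous_tauAc_of_finite_fibers {S T : Type*} {f : WithZero S → WithZero T}
    (h0 : f 0 = 0) (hf : ∀ b : T, {x : S | f x = b}.Finite) :
    @Continuous _ _ (tauAc S) (tauAc T) f := by
  let _ := tauAc S
  let _ := tauAc T
  refine continuous_def.2 fun U hU => isOpen_tauAc_iff.2 fun h => ?_
  rw [Set.mem_preimage, h0] at h
  rw [← Set.preimage_compl]
  refine Set.Finite.preimage' (isOpen_tauAc_iff.1 hU h) fun b hb => ?_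
  cases b with
  | zero => exact absurd h hb
  | coe b =>
    refine ((hf b).image (fun x : S => (x : WithZero S))).subset fun x hx => ?_
    cases x with
    | zero => exact absurd (h0.symm.trans hx) WithZero.zero_ne_coe
    | coe x => exact ⟨x, hx, rfl⟩

/-- if `T` is a semigroup with the `F`-property (for all
`a, b, c, d ∈ T¹` the sets `{x ∈ T : a·x = b}` and `{x ∈ T : x·c = d}` are
finite), then `(T⁰, τ_Ac)` is a Hausdorff compact semitopological semigroup. -/
theorem stmt16 (T : Type*) [Semigroup T]
    (hF1 : ∀ a b : WithOne T, {x : T | a * (x : WithOne T) = b}.Finite)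
    (hF2 : ∀ c d : WithOne T, {x : T | (x : WithOne T) * c = d}.Finite) :
    @T2Space (WithZero T) (tauAc T) ∧ @CompactSpace (WithZero T) (tauAc T) ∧
    (∀ a : WithZero T, @Continuous _ _ (tauAc T) (tauAc T) fun x => a * x) ∧
    (∀ a : WithZero T, @Continuous _ _ (tauAc T) (tauAc T) fun x => x * a) := by
  refine ⟨t2Space_tauAc T, compactSpace_tauAc T, fun a => ?_, fun a => ?_⟩
  · cases a with
    | zero =>
      simp only [zero_mul]
      exact @continuous_const _ _ (tauAc T) (tauAc T) 0
    | coe a =>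
      refine continuous_tauAc_of_finite_fibers (mul_zero _) fun b => (hF1 a b).subset fun x hx => ?_
      exact congrArg WithOne.coe (WithZero.coe_injective hx : a * x = b)
  · cases a with
    | zero =>
      simp only [mul_zero]
      exact @continuous_const _ _ (tauAc T) (tauAc T) 0
    | coe a =>
      refine continuous_tauAc_of_finite_fibers (zero_mul _) fun b => (hF2 a b).subset fun x hx => ?_
      exact congrArg WithOne.coe (WithZero.coe_injective hx : x * a = b)

end GK
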